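/- For each i ∈ {1,2,3}, the five functions Lᵢ, I₁₂, I₂₃, I₁₂₃ and H^GKC_i are functionally independent on D; that is, there exists a point of D at which their five gradients (vectors in ℝ⁶) are linearly independent. Consequently each H^GKC_i is a maximally superintegrable Hamiltonian. -/

import Mathlib

namespace Paper
noncomputable section

/-- The κ-dependent cosine Cκ(x) = ∑ (−κ)^l x^{2l}/(2l)!. -/
def Ck (κ x : ℝ) : ℝ := ∑' l : ℕ, (-κ) ^ l * x ^ (2 * l) / (Nat.factorial (2 * l) : ℝ)

/-- The κ-dependent sine Sκ(x) = ∑ (−κ)^l x^{2l+1}/(2l+1)!. -/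
def Sk (κ x : ℝ) : ℝ := ∑' l : ℕ, (-κ) ^ l * x ^ (2 * l + 1) / (Nat.factorial (2 * l + 1) : ℝ)

/-- The κ-dependent tangent Tκ(x) = Sκ(x)/Cκ(x). -/
def Tk (κ x : ℝ) : ℝ := Sk κ x / Ck κ x

/-- Phase space ℝ³ × ℝ³ ≃ ℝ⁶ with canonical coordinates
`(r, θ, φ, p_r, p_θ, p_φ) = (x 0, x 1, x 2, x 3, x 4, x 5)`. -/
abbrev Pt := Fin 6 → ℝ

/-- Partial derivative in the i-th coordinate direction. -/
def pd (f : Pt → ℝ) (i : Fin 6) (x : Pt) : ℝ := fderiv ℝ f x (Pi.single i 1)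

/-- Canonical Poisson bracket {f,g} = ∑_{q} (∂f/∂q ∂g/∂p_q − ∂g/∂q ∂f/∂p_q). -/
def pb (f g : Pt → ℝ) (x : Pt) : ℝ :=
  ∑ i : Fin 3,
    (pd f ⟨i.1, by omega⟩ x * pd g ⟨i.1 + 3, by omega⟩ x
      - pd g ⟨i.1, by omega⟩ x * pd f ⟨i.1 + 3, by omega⟩ x)

/-- Gradient of a function on phase space, as a vector in ℝ⁶. -/
def grad (f : Pt → ℝ) (x : Pt) : Fin 6 → ℝ := fun i => pd f i x

/-- The open domain D where Sκ₁(r), Cκ₁(r), Sκ₂(θ), Cκ₂(θ), cos φ, sin φ are nonzero. -/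
def D (κ₁ κ₂ : ℝ) : Set Pt :=
  {x | Sk κ₁ (x 0) ≠ 0 ∧ Ck κ₁ (x 0) ≠ 0 ∧ Sk κ₂ (x 1) ≠ 0 ∧ Ck κ₂ (x 1) ≠ 0 ∧
       Real.cos (x 2) ≠ 0 ∧ Real.sin (x 2) ≠ 0}

/-- J₀₁ = Cκ₂(θ)p_r − (Sκ₂(θ)/Tκ₁(r))p_θ. -/
def J01 (κ₁ κ₂ : ℝ) (x : Pt) : ℝ :=
  Ck κ₂ (x 1) * x 3 - (Sk κ₂ (x 1) / Tk κ₁ (x 0)) * x 4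

/-- J₀₂. -/
def J02 (κ₁ κ₂ : ℝ) (x : Pt) : ℝ :=
  κ₂ * Sk κ₂ (x 1) * Real.cos (x 2) * x 3
    + (Ck κ₂ (x 1) * Real.cos (x 2) / Tk κ₁ (x 0)) * x 4
    - (Real.sin (x 2) / (Tk κ₁ (x 0) * Sk κ₂ (x 1))) * x 5

/-- J₀₃. -/
def J03 (κ₁ κ₂ : ℝ) (x : Pt) : ℝ :=
  κ₂ * Sk κ₂ (x 1) * Real.sin (x 2) * x 3
    + (Ck κ₂ (x 1) * Real.sin (x 2) / Tk κ₁ (x 0)) * x 4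
    + (Real.cos (x 2) / (Tk κ₁ (x 0) * Sk κ₂ (x 1))) * x 5

/-- J₁₂ = cos φ·p_θ − (sin φ/Tκ₂(θ))p_φ. -/
def J12 (κ₂ : ℝ) (x : Pt) : ℝ :=
  Real.cos (x 2) * x 4 - (Real.sin (x 2) / Tk κ₂ (x 1)) * x 5

/-- J₁₃ = sin φ·p_θ + (cos φ/Tκ₂(θ))p_φ. -/
def J13 (κ₂ : ℝ) (x : Pt) : ℝ :=
  Real.sin (x 2) * x 4 + (Real.cos (x 2) / Tk κ₂ (x 1)) * x 5

/-- J₂₃ = p_φ. -/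
def J23 (x : Pt) : ℝ := x 5

/-- Kinetic energy T. -/
def Tkin (κ₁ κ₂ : ℝ) (x : Pt) : ℝ :=
  (1 / 2) * ((x 3) ^ 2 + (x 4) ^ 2 / (κ₂ * Sk κ₁ (x 0) ^ 2)
    + (x 5) ^ 2 / (κ₂ * Sk κ₁ (x 0) ^ 2 * Sk κ₂ (x 1) ^ 2))

/-- The superintegrable potential U with arbitrary radial function F. -/
def U (κ₁ κ₂ : ℝ) (F : ℝ → ℝ) (β₁ β₂ β₃ : ℝ) (x : Pt) : ℝ :=
  F (x 0) + (1 / Sk κ₁ (x 0) ^ 2) *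
    (β₁ / Ck κ₂ (x 1) ^ 2 + β₂ / (Sk κ₂ (x 1) ^ 2 * Real.cos (x 2) ^ 2)
      + β₃ / (Sk κ₂ (x 1) ^ 2 * Real.sin (x 2) ^ 2))

/-- Integral I₁₂. -/
def I12 (κ₂ β₁ β₂ : ℝ) (x : Pt) : ℝ :=
  (Real.cos (x 2) * x 4 - (Real.sin (x 2) / Tk κ₂ (x 1)) * x 5) ^ 2
    + 2 * β₁ * κ₂ ^ 2 * Tk κ₂ (x 1) ^ 2 * Real.cos (x 2) ^ 2
    + 2 * β₂ * κ₂ / (Tk κ₂ (x 1) ^ 2 * Real.cos (x 2) ^ 2)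

/-- Integral I₁₃. -/
def I13 (κ₂ β₁ β₃ : ℝ) (x : Pt) : ℝ :=
  (Real.sin (x 2) * x 4 + (Real.cos (x 2) / Tk κ₂ (x 1)) * x 5) ^ 2
    + 2 * β₁ * κ₂ ^ 2 * Tk κ₂ (x 1) ^ 2 * Real.sin (x 2) ^ 2
    + 2 * β₃ * κ₂ / (Tk κ₂ (x 1) ^ 2 * Real.sin (x 2) ^ 2)

/-- Integral I₂₃. -/
def I23 (κ₂ β₂ β₃ : ℝ) (x : Pt) : ℝ :=
  (x 5) ^ 2 + 2 * β₂ * κ₂ * Real.tan (x 2) ^ 2 + 2 * β₃ * κ₂ / Real.tan (x 2) ^ 2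

/-- Integral I₁₂₃. -/
def I123 (κ₂ β₁ β₂ β₃ : ℝ) (x : Pt) : ℝ :=
  (x 4) ^ 2 + (x 5) ^ 2 / Sk κ₂ (x 1) ^ 2 + 2 * β₁ * κ₂ / Ck κ₂ (x 1) ^ 2
    + 2 * β₂ * κ₂ / (Sk κ₂ (x 1) ^ 2 * Real.cos (x 2) ^ 2)
    + 2 * β₃ * κ₂ / (Sk κ₂ (x 1) ^ 2 * Real.sin (x 2) ^ 2)

/-- The Smorodinsky–Winternitz Hamiltonian H^SW. -/
def HSW (κ₁ κ₂ β₀ β₁ β₂ β₃ : ℝ) (x : Pt) : ℝ :=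
  Tkin κ₁ κ₂ x + β₀ * Tk κ₁ (x 0) ^ 2 + (1 / Sk κ₁ (x 0) ^ 2) *
    (β₁ / Ck κ₂ (x 1) ^ 2 + β₂ / (Sk κ₂ (x 1) ^ 2 * Real.cos (x 2) ^ 2)
      + β₃ / (Sk κ₂ (x 1) ^ 2 * Real.sin (x 2) ^ 2))

/-- Integral I₀₁ of H^SW. -/
def I01 (κ₁ κ₂ β₀ β₁ : ℝ) (x : Pt) : ℝ :=
  J01 κ₁ κ₂ x ^ 2 + 2 * β₀ * Tk κ₁ (x 0) ^ 2 * Ck κ₂ (x 1) ^ 2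
    + 2 * β₁ / (Tk κ₁ (x 0) ^ 2 * Ck κ₂ (x 1) ^ 2)

/-- Integral I₀₂ of H^SW. -/
def I02 (κ₁ κ₂ β₀ β₂ : ℝ) (x : Pt) : ℝ :=
  J02 κ₁ κ₂ x ^ 2 + 2 * β₀ * κ₂ ^ 2 * Tk κ₁ (x 0) ^ 2 * Sk κ₂ (x 1) ^ 2 * Real.cos (x 2) ^ 2
    + 2 * β₂ * κ₂ / (Tk κ₁ (x 0) ^ 2 * Sk κ₂ (x 1) ^ 2 * Real.cos (x 2) ^ 2)

/-- Integral I₀₃ of H^SW. -/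
def I03 (κ₁ κ₂ β₀ β₃ : ℝ) (x : Pt) : ℝ :=
  J03 κ₁ κ₂ x ^ 2 + 2 * β₀ * κ₂ ^ 2 * Tk κ₁ (x 0) ^ 2 * Sk κ₂ (x 1) ^ 2 * Real.sin (x 2) ^ 2
    + 2 * β₃ * κ₂ / (Tk κ₁ (x 0) ^ 2 * Sk κ₂ (x 1) ^ 2 * Real.sin (x 2) ^ 2)

/-- Generalized Kepler–Coulomb Hamiltonian H^GKC₁ = T + U^GKC₁. -/
def HGKC1 (κ₁ κ₂ k β₂ β₃ : ℝ) (x : Pt) : ℝ :=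
  Tkin κ₁ κ₂ x - k / Tk κ₁ (x 0)
    + (1 / (Sk κ₁ (x 0) ^ 2 * Sk κ₂ (x 1) ^ 2)) *
        (β₂ / Real.cos (x 2) ^ 2 + β₃ / Real.sin (x 2) ^ 2)

/-- Generalized Kepler–Coulomb Hamiltonian H^GKC₂ = T + U^GKC₂. -/
def HGKC2 (κ₁ κ₂ k β₁ β₃ : ℝ) (x : Pt) : ℝ :=
  Tkin κ₁ κ₂ x - k / Tk κ₁ (x 0)
    + (1 / Sk κ₁ (x 0) ^ 2) *
        (β₁ / Ck κ₂ (x 1) ^ 2 + β₃ / (Sk κ₂ (x 1) ^ 2 * Real.sin (x 2) ^ 2))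

/-- Generalized Kepler–Coulomb Hamiltonian H^GKC₃ = T + U^GKC₃. -/
def HGKC3 (κ₁ κ₂ k β₁ β₂ : ℝ) (x : Pt) : ℝ :=
  Tkin κ₁ κ₂ x - k / Tk κ₁ (x 0)
    + (1 / Sk κ₁ (x 0) ^ 2) *
        (β₁ / Ck κ₂ (x 1) ^ 2 + β₂ / (Sk κ₂ (x 1) ^ 2 * Real.cos (x 2) ^ 2))

/-- The function L₁. -/
def L1 (κ₁ κ₂ k β₂ β₃ : ℝ) (x : Pt) : ℝ :=
  -(J02 κ₁ κ₂ x * J12 κ₂ x) - J03 κ₁ κ₂ x * J13 κ₂ x + k * κ₂ * Ck κ₂ (x 1)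
    - (2 * κ₂ * Ck κ₂ (x 1) / (Tk κ₁ (x 0) * Sk κ₂ (x 1) ^ 2)) *
        (β₂ / Real.cos (x 2) ^ 2 + β₃ / Real.sin (x 2) ^ 2)

/-- The function L₂. -/
def L2 (κ₁ κ₂ k β₁ β₃ : ℝ) (x : Pt) : ℝ :=
  J01 κ₁ κ₂ x * J12 κ₂ x - J03 κ₁ κ₂ x * J23 x + k * κ₂ * Sk κ₂ (x 1) * Real.cos (x 2)
    - (2 * κ₂ * Real.cos (x 2) / Tk κ₁ (x 0)) *
        (β₁ * Sk κ₂ (x 1) / Ck κ₂ (x 1) ^ 2 + β₃ / (Sk κ₂ (x 1) * Real.sin (x 2) ^ 2))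

/-- The function L₃. -/
def L3 (κ₁ κ₂ k β₁ β₂ : ℝ) (x : Pt) : ℝ :=
  J01 κ₁ κ₂ x * J13 κ₂ x + J02 κ₁ κ₂ x * J23 x + k * κ₂ * Sk κ₂ (x 1) * Real.sin (x 2)
    - (2 * κ₂ * Real.sin (x 2) / Tk κ₁ (x 0)) *
        (β₁ * Sk κ₂ (x 1) / Ck κ₂ (x 1) ^ 2 + β₂ / (Sk κ₂ (x 1) * Real.cos (x 2) ^ 2))

theorem Ck_zero_left (x : ℝ) : Ck 0 x = 1 := by
  rw [Ck, tsum_eq_single 0 (fun l hl => by simp [hl])]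
  simp

theorem Sk_zero_left (x : ℝ) : Sk 0 x = x := by
  rw [Sk, tsum_eq_single 0 (fun l hl => by simp [hl])]
  simp

theorem Ck_sq (a x : ℝ) : Ck (a ^ 2) x = Real.cos (a * x) := by
  rw [Ck, ← (Real.hasSum_cos (a * x)).tsum_eq]
  refine tsum_congr fun l => ?_
  rw [neg_pow (a ^ 2), mul_pow, pow_mul a]
  ring

theorem Sk_sq {a : ℝ} (ha : a ≠ 0) (x : ℝ) : Sk (a ^ 2) x = Real.sin (a * x) / a := by
  rw [Sk, ← (Real.hasSum_sin (a * x)).tsum_eq, ← tsum_div_const]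
  refine tsum_congr fun l => ?_
  rw [neg_pow (a ^ 2), mul_pow, pow_succ a (2 * l), pow_mul a]
  field_simp

theorem Ck_neg_sq (a x : ℝ) : Ck (-a ^ 2) x = Real.cosh (a * x) := by
  rw [Ck, ← (Real.hasSum_cosh (a * x)).tsum_eq]
  refine tsum_congr fun l => ?_
  rw [neg_neg, mul_pow, pow_mul a]

theorem Sk_neg_sq {a : ℝ} (ha : a ≠ 0) (x : ℝ) : Sk (-a ^ 2) x = Real.sinh (a * x) / a := by
  rw [Sk, ← (Real.hasSum_sinh (a * x)).tsum_eq, ← tsum_div_const]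
  refine tsum_congr fun l => ?_
  rw [neg_neg, mul_pow, pow_succ a (2 * l), pow_mul a]
  field_simp

/-- Every real curvature is zero, a positive square, or minus a positive square. -/
theorem eq_zero_or_sq_or_neg_sq (κ : ℝ) :
    κ = 0 ∨ (∃ a : ℝ, a ≠ 0 ∧ κ = a ^ 2) ∨ ∃ a : ℝ, a ≠ 0 ∧ κ = -a ^ 2 := by
  rcases lt_trichotomy κ 0 with h | h | h
  · refine Or.inr (Or.inr ⟨√(-κ), (Real.sqrt_pos.2 (by linarith)).ne', ?_⟩)
    rw [Real.sq_sqrt (by linarith), neg_neg]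
  · exact Or.inl h
  · exact Or.inr (Or.inl ⟨√κ, (Real.sqrt_pos.2 h).ne', (Real.sq_sqrt h.le).symm⟩)

theorem hasDerivAt_Sk (κ x : ℝ) : HasDerivAt (Sk κ) (Ck κ x) x := by
  rcases eq_zero_or_sq_or_neg_sq κ with rfl | ⟨a, ha, rfl⟩ | ⟨a, ha, rfl⟩
  · rw [funext Sk_zero_left, Ck_zero_left]
    exact hasDerivAt_id' x
  · rw [funext (Sk_sq ha), Ck_sq]
    refine ((((hasDerivAt_id' x).const_mul a).sin).div_const a).congr_deriv ?_
    field_simp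
  · rw [funext (Sk_neg_sq ha), Ck_neg_sq]
    refine ((((hasDerivAt_id' x).const_mul a).sinh).div_const a).congr_deriv ?_
    field_simp

theorem hasDerivAt_Ck (κ x : ℝ) : HasDerivAt (Ck κ) (-κ * Sk κ x) x := by
  rcases eq_zero_or_sq_or_neg_sq κ with rfl | ⟨a, ha, rfl⟩ | ⟨a, ha, rfl⟩
  · rw [funext Ck_zero_left]
    simpa using hasDerivAt_const x (1 : ℝ)
  · rw [funext (Ck_sq a), Sk_sq ha]
    refine (((hasDerivAt_id' x).const_mul a).cos).congr_deriv ?_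
    field_simp
  · rw [funext (Ck_neg_sq a), Sk_neg_sq ha]
    refine (((hasDerivAt_id' x).const_mul a).cosh).congr_deriv ?_
    field_simp

theorem Ck_sq_add_Sk_sq (κ x : ℝ) : Ck κ x ^ 2 + κ * Sk κ x ^ 2 = 1 := by
  rcases eq_zero_or_sq_or_neg_sq κ with rfl | ⟨a, ha, rfl⟩ | ⟨a, ha, rfl⟩
  · simp [Ck_zero_left]
  · rw [Ck_sq, Sk_sq ha]
    field_simp
    exact Real.cos_sq_add_sin_sq _
  · rw [Ck_neg_sq, Sk_neg_sq ha]
    field_simp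
    linarith [Real.cosh_sq (a * x)]

theorem hasDerivAt_of_eq {f g : ℝ → ℝ} {d e x : ℝ} (h : HasDerivAt f d x) (hg : ∀ t, g t = f t)
    (he : d = e) : HasDerivAt g e x := by
  rw [funext hg, ← he]
  exact h

theorem hasDerivAt_Sk_div_Ck {κ x : ℝ} (h : Ck κ x ≠ 0) :
    HasDerivAt (fun t => Sk κ t / Ck κ t) (1 / Ck κ x ^ 2) x := by
  refine ((hasDerivAt_Sk κ x).div (hasDerivAt_Ck κ x) h).congr_deriv ?_
  congr 1
  linarith [Ck_sq_add_Sk_sq κ x]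

theorem hasDerivAt_Ck_div_Sk {κ x : ℝ} (h : Sk κ x ≠ 0) :
    HasDerivAt (fun t => Ck κ t / Sk κ t) (-1 / Sk κ x ^ 2) x := by
  refine ((hasDerivAt_Ck κ x).div (hasDerivAt_Sk κ x) h).congr_deriv ?_
  congr 1
  linarith [Ck_sq_add_Sk_sq κ x]

@[fun_prop]
theorem DifferentiableAt.Sk {E : Type*} [NormedAddCommGroup E] [NormedSpace ℝ E] {κ : ℝ}
    {f : E → ℝ} {x : E} (hf : DifferentiableAt ℝ f x) :
    DifferentiableAt ℝ (fun y => Sk κ (f y)) x :=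
  (hasDerivAt_Sk κ (f x)).differentiableAt.comp x hf

@[fun_prop]
theorem DifferentiableAt.Ck {E : Type*} [NormedAddCommGroup E] [NormedSpace ℝ E] {κ : ℝ}
    {f : E → ℝ} {x : E} (hf : DifferentiableAt ℝ f x) :
    DifferentiableAt ℝ (fun y => Ck κ (f y)) x :=
  (hasDerivAt_Ck κ (f x)).differentiableAt.comp x hf

theorem exists_Sk_ne_zero_and_Ck_ne_zero (κ : ℝ) : ∃ r, Sk κ r ≠ 0 ∧ Ck κ r ≠ 0 := by
  have h0 : Ck κ 0 = 1 := by
    rw [Ck, tsum_eq_single 0 (fun l hl => by simp [hl])]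
    simp
  have hS := (hasDerivAt_Sk κ 0).eventually_ne (c := 0) (by simp [h0])
  have hC : ∀ᶠ r in nhdsWithin 0 {0}ᶜ, Ck κ r ≠ 0 :=
    ((hasDerivAt_Ck κ 0).continuousAt.eventually_ne (by simp [h0])).filter_mono nhdsWithin_le_nhds
  exact (hS.and hC).exists

theorem pd_eq_of_hasDerivAt {f : Pt → ℝ} {i : Fin 6} {x : Pt} {d : ℝ} (g : ℝ → Pt)
    (hf : DifferentiableAt ℝ f x) (hg : ∀ t, Function.update x i t = g t)
    (h : HasDerivAt (fun t => f (g t)) d (x i)) : pd f i x = d := by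
  have hu := hasDerivAt_update x i (x i)
  have hf' : HasFDerivAt f (fderiv ℝ f x) (Function.update x i (x i)) := by
    rw [Function.update_eq_self]
    exact hf.hasFDerivAt
  have h' := hf'.comp_hasDerivAt (x i) hu
  simp only [Function.comp_def, hg] at h'
  exact h'.unique h

theorem pd_eq_zero {f : Pt → ℝ} {i : Fin 6} {x : Pt} (hf : DifferentiableAt ℝ f x)
    (h : ∀ t, f (Function.update x i t) = f x) : pd f i x = 0 := by
  refine pd_eq_of_hasDerivAt _ hf (fun _ => rfl) ?_
  simp only [h]
  exact hasDerivAt_const _ _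

section Differentiability

variable {κ₁ κ₂ : ℝ} {x : Pt}

theorem differentiableAt_I12 (β₁ β₂ : ℝ) (hx : x ∈ D κ₁ κ₂) :
    DifferentiableAt ℝ (I12 κ₂ β₁ β₂) x := by
  obtain ⟨-, -, h3, h4, h5, -⟩ := hx
  unfold I12 Tk
  fun_prop (disch := simp [*])

theorem differentiableAt_I23 (β₂ β₃ : ℝ) (hx : x ∈ D κ₁ κ₂) :
    DifferentiableAt ℝ (I23 κ₂ β₂ β₃) x := by
  obtain ⟨-, -, -, -, h5, h6⟩ := hx
  unfold I23
  simp only [Real.tan_eq_sin_div_cos]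
  fun_prop (disch := simp [*])

theorem differentiableAt_I123 (β₁ β₂ β₃ : ℝ) (hx : x ∈ D κ₁ κ₂) :
    DifferentiableAt ℝ (I123 κ₂ β₁ β₂ β₃) x := by
  obtain ⟨-, -, h3, h4, h5, h6⟩ := hx
  unfold I123
  fun_prop (disch := simp [*])

theorem differentiableAt_HGKC1 (hκ₂ : κ₂ ≠ 0) (k β₂ β₃ : ℝ) (hx : x ∈ D κ₁ κ₂) :
    DifferentiableAt ℝ (HGKC1 κ₁ κ₂ k β₂ β₃) x := by
  obtain ⟨h1, h2, h3, h4, h5, h6⟩ := hx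
  unfold HGKC1 Tkin Tk
  fun_prop (disch := simp [*])

theorem differentiableAt_HGKC2 (hκ₂ : κ₂ ≠ 0) (k β₁ β₃ : ℝ) (hx : x ∈ D κ₁ κ₂) :
    DifferentiableAt ℝ (HGKC2 κ₁ κ₂ k β₁ β₃) x := by
  obtain ⟨h1, h2, h3, h4, h5, h6⟩ := hx
  unfold HGKC2 Tkin Tk
  fun_prop (disch := simp [*])

theorem differentiableAt_HGKC3 (hκ₂ : κ₂ ≠ 0) (k β₁ β₂ : ℝ) (hx : x ∈ D κ₁ κ₂) :
    DifferentiableAt ℝ (HGKC3 κ₁ κ₂ k β₁ β₂) x := by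
  obtain ⟨h1, h2, h3, h4, h5, h6⟩ := hx
  unfold HGKC3 Tkin Tk
  fun_prop (disch := simp [*])

theorem differentiableAt_L1 (k β₂ β₃ : ℝ) (hx : x ∈ D κ₁ κ₂) :
    DifferentiableAt ℝ (L1 κ₁ κ₂ k β₂ β₃) x := by
  obtain ⟨h1, h2, h3, h4, h5, h6⟩ := hx
  unfold L1 J02 J03 J12 J13 Tk
  fun_prop (disch := simp [*])

theorem differentiableAt_L2 (k β₁ β₃ : ℝ) (hx : x ∈ D κ₁ κ₂) :
    DifferentiableAt ℝ (L2 κ₁ κ₂ k β₁ β₃) x := by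
  obtain ⟨h1, h2, h3, h4, h5, h6⟩ := hx
  unfold L2 J01 J03 J12 J23 Tk
  fun_prop (disch := simp [*])

theorem differentiableAt_L3 (k β₁ β₂ : ℝ) (hx : x ∈ D κ₁ κ₂) :
    DifferentiableAt ℝ (L3 κ₁ κ₂ k β₁ β₂) x := by
  obtain ⟨h1, h2, h3, h4, h5, h6⟩ := hx
  unfold L3 J01 J02 J13 J23 Tk
  fun_prop (disch := simp [*])

end Differentiability

/-- Five covectors are linearly independent as soon as the middle three have no radial components
and the radial and angular minors are nonzero. -/
theorem linearIndependent_of_minors {g₀ g₁ g₂ g₃ g₄ : Fin 6 → ℝ}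
    (h₁ : g₁ 0 = 0 ∧ g₁ 3 = 0) (h₂ : g₂ 0 = 0 ∧ g₂ 3 = 0) (h₃ : g₃ 0 = 0 ∧ g₃ 3 = 0)
    (hrad : g₀ 0 * g₄ 3 - g₀ 3 * g₄ 0 ≠ 0) (h₂' : g₂ 1 = 0 ∧ g₂ 4 = 0 ∧ g₂ 5 ≠ 0)
    (hang : g₁ 1 * g₃ 4 - g₁ 4 * g₃ 1 ≠ 0) : LinearIndependent ℝ ![g₀, g₁, g₂, g₃, g₄] := by
  rw [Fintype.linearIndependent_iff]
  intro c hc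
  have e : ∀ j, c 0 * g₀ j + c 1 * g₁ j + c 2 * g₂ j + c 3 * g₃ j + c 4 * g₄ j = 0 := by
    intro j
    simpa [Fin.sum_univ_five] using congrFun hc j
  have e0 := e 0
  have e3 := e 3
  rw [h₁.1, h₂.1, h₃.1] at e0
  rw [h₁.2, h₂.2, h₃.2] at e3
  have c0 : c 0 = 0 := (mul_eq_zero.1 (by linear_combination g₄ 3 * e0 - g₄ 0 * e3 :
    c 0 * (g₀ 0 * g₄ 3 - g₀ 3 * g₄ 0) = 0)).resolve_right hrad
  have c4 : c 4 = 0 := (mul_eq_zero.1 (by linear_combination g₀ 0 * e3 - g₀ 3 * e0 :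
    c 4 * (g₀ 0 * g₄ 3 - g₀ 3 * g₄ 0) = 0)).resolve_right hrad
  have e1 := e 1
  have e4 := e 4
  have e5 := e 5
  rw [h₂'.1, c0, c4] at e1
  rw [h₂'.2.1, c0, c4] at e4
  have c1 : c 1 = 0 := (mul_eq_zero.1 (by linear_combination g₃ 4 * e1 - g₃ 1 * e4 :
    c 1 * (g₁ 1 * g₃ 4 - g₁ 4 * g₃ 1) = 0)).resolve_right hang
  have c3 : c 3 = 0 := (mul_eq_zero.1 (by linear_combination g₁ 1 * e4 - g₁ 4 * e1 :
    c 3 * (g₁ 1 * g₃ 4 - g₁ 4 * g₃ 1) = 0)).resolve_right hang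
  have c2 : c 2 = 0 := by
    rw [c0, c1, c3, c4] at e5
    simpa [h₂'.2.2] using e5
  intro i
  fin_cases i <;> assumption

/-- A quadratic with nonzero leading coefficient and a monic even quadratic have a common
non-root. -/
theorem exists_quadratic_ne_zero {a : ℝ} (ha : a ≠ 0) (b c d : ℝ) :
    ∃ q : ℝ, a * q ^ 2 + b * q + c ≠ 0 ∧ q ^ 2 + d ≠ 0 := by
  open Polynomial in
  have hp : (C a * X ^ 2 + C b * X + C c : ℝ[X]) ≠ 0 := by
    intro h
    have := congrArg (fun p : ℝ[X] => p.coeff 2) h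
    simp at this
    exact ha this
  have hq : (X ^ 2 + C d : ℝ[X]) ≠ 0 := X_pow_add_C_ne_zero (by norm_num) d
  obtain ⟨q, hq⟩ := exists_eval_ne_zero_of_natDegree_lt_card _ (mul_ne_zero hp hq)
    ((Cardinal.natCast_lt_aleph0).trans_le (Cardinal.aleph0_le_mk ℝ))
  refine ⟨q, ?_⟩
  simpa [not_or] using hq

section AngularDerivatives

/-- The potential part of `∂I₁₂/∂θ`. -/
def potentialDerivI12 (κ₂ β₁ β₂ θ φ : ℝ) : ℝ :=
  4 * β₁ * κ₂ ^ 2 * Sk κ₂ θ * Real.cos φ ^ 2 / Ck κ₂ θ ^ 3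
    - 4 * β₂ * κ₂ * Ck κ₂ θ / (Sk κ₂ θ ^ 3 * Real.cos φ ^ 2)

/-- The derivative `∂I₁₂₃/∂θ` at `p_φ = 1`. -/
def derivI123 (κ₂ β₁ β₂ β₃ θ φ : ℝ) : ℝ :=
  -2 * Ck κ₂ θ / Sk κ₂ θ ^ 3 + 4 * β₁ * κ₂ ^ 2 * Sk κ₂ θ / Ck κ₂ θ ^ 3
    - 4 * β₂ * κ₂ * Ck κ₂ θ / (Sk κ₂ θ ^ 3 * Real.cos φ ^ 2)
    - 4 * β₃ * κ₂ * Ck κ₂ θ / (Sk κ₂ θ ^ 3 * Real.sin φ ^ 2)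

variable {κ₂ θ φ : ℝ} (β₁ β₂ β₃ r p q : ℝ)

theorem hasDerivAt_I12_theta (hS : Sk κ₂ θ ≠ 0) (hC : Ck κ₂ θ ≠ 0) (hcos : Real.cos φ ≠ 0) :
    HasDerivAt (fun t => I12 κ₂ β₁ β₂ ![r, t, φ, p, q, 1])
      (2 * (Real.cos φ * q - Real.sin φ * (Ck κ₂ θ / Sk κ₂ θ)) * (Real.sin φ / Sk κ₂ θ ^ 2)
        + potentialDerivI12 κ₂ β₁ β₂ θ φ) θ := by
  have dcot := hasDerivAt_Ck_div_Sk hS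
  have dtan := hasDerivAt_Sk_div_Ck hC
  have := (((dcot.const_mul (Real.sin φ)).const_sub (Real.cos φ * q)).pow 2).add
    (((dtan.pow 2).const_mul (2 * β₁ * κ₂ ^ 2 * Real.cos φ ^ 2)).add
      ((dcot.pow 2).const_mul (2 * β₂ * κ₂ / Real.cos φ ^ 2)))
  refine hasDerivAt_of_eq this (fun t => ?_) ?_
  · simp [I12, Tk, div_pow, div_div_eq_mul_div, div_mul_eq_mul_div]
    ring
  · simp [potentialDerivI12]
    field_simp
    ring

theorem hasDerivAt_I12_ptheta :
    HasDerivAt (fun t => I12 κ₂ β₁ β₂ ![r, θ, φ, p, t, 1])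
      (2 * (Real.cos φ * q - Real.sin φ * (Ck κ₂ θ / Sk κ₂ θ)) * Real.cos φ) q := by
  have := ((((hasDerivAt_id' q).const_mul (Real.cos φ)).sub_const
    (Real.sin φ * (Ck κ₂ θ / Sk κ₂ θ))).pow 2).add_const
    (2 * β₁ * κ₂ ^ 2 * (Sk κ₂ θ / Ck κ₂ θ) ^ 2 * Real.cos φ ^ 2
      + 2 * β₂ * κ₂ / ((Sk κ₂ θ / Ck κ₂ θ) ^ 2 * Real.cos φ ^ 2))
  refine hasDerivAt_of_eq this (fun t => ?_) ?_
  · simp [I12, Tk, div_div_eq_mul_div]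
    ring
  · simp

theorem hasDerivAt_I123_theta (hS : Sk κ₂ θ ≠ 0) (hC : Ck κ₂ θ ≠ 0) (hcos : Real.cos φ ≠ 0)
    (hsin : Real.sin φ ≠ 0) :
    HasDerivAt (fun t => I123 κ₂ β₁ β₂ β₃ ![r, t, φ, p, q, 1]) (derivI123 κ₂ β₁ β₂ β₃ θ φ) θ := by
  have iS := ((hasDerivAt_Sk κ₂ θ).pow 2).inv (pow_ne_zero 2 hS)
  have iC := ((hasDerivAt_Ck κ₂ θ).pow 2).inv (pow_ne_zero 2 hC)
  have := ((iS.const_mul (1 + 2 * β₂ * κ₂ / Real.cos φ ^ 2 + 2 * β₃ * κ₂ / Real.sin φ ^ 2)).add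
    (iC.const_mul (2 * β₁ * κ₂))).const_add (q ^ 2)
  refine hasDerivAt_of_eq this (fun t => ?_) ?_
  · simp [I123]
    ring
  · simp [derivI123]
    field_simp
    ring

theorem hasDerivAt_I123_ptheta :
    HasDerivAt (fun t => I123 κ₂ β₁ β₂ β₃ ![r, θ, φ, p, t, 1]) (2 * q) q := by
  have := ((hasDerivAt_id' q).pow 2).add_const (1 / Sk κ₂ θ ^ 2 + 2 * β₁ * κ₂ / Ck κ₂ θ ^ 2
    + 2 * β₂ * κ₂ / (Sk κ₂ θ ^ 2 * Real.cos φ ^ 2) + 2 * β₃ * κ₂ / (Sk κ₂ θ ^ 2 * Real.sin φ ^ 2))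
  refine hasDerivAt_of_eq this (fun t => ?_) ?_
  · simp [I123]
    ring
  · simp

theorem hasDerivAt_I23_pphi :
    HasDerivAt (fun t => I23 κ₂ β₂ β₃ ![r, θ, φ, p, q, t]) 2 1 := by
  have := ((hasDerivAt_id' (1 : ℝ)).pow 2).add_const (2 * β₂ * κ₂ * Real.tan φ ^ 2
    + 2 * β₃ * κ₂ / Real.tan φ ^ 2)
  refine hasDerivAt_of_eq this (fun t => ?_) ?_
  · simp [I23]
    ring
  · simp

end AngularDerivatives

/-- If `L` and `H` have the radial structure of the Kepler–Coulomb integrals and Hamiltonians, then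
they are functionally independent together with the angular integrals. -/
theorem exists_mem_D_linearIndependent {κ₁ κ₂ k β₁ β₂ β₃ θ φ m : ℝ} {L H : Pt → ℝ} {A E : ℝ → ℝ}
    (hS : Sk κ₂ θ ≠ 0) (hC : Ck κ₂ θ ≠ 0) (hcos : Real.cos φ ≠ 0) (hsin : Real.sin φ ≠ 0)
    (hm : m ≠ 0)
    (hL : ∀ r p q, L ![r, θ, φ, p, q, 1] =
      A q * p - m * I123 κ₂ β₁ β₂ β₃ ![0, θ, φ, 0, q, 1] * (Ck κ₁ r / Sk κ₁ r) + E q)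
    (hH : ∀ r p q, H ![r, θ, φ, p, q, 1] =
      p ^ 2 / 2 - k * (Ck κ₁ r / Sk κ₁ r) +
        I123 κ₂ β₁ β₂ β₃ ![0, θ, φ, 0, q, 1] / (2 * κ₂) * (1 / Sk κ₁ r ^ 2))
    (hLd : ∀ x ∈ D κ₁ κ₂, DifferentiableAt ℝ L x) (hHd : ∀ x ∈ D κ₁ κ₂, DifferentiableAt ℝ H x) :
    ∃ x ∈ D κ₁ κ₂, LinearIndependent ℝ
      ![grad L x, grad (I12 κ₂ β₁ β₂) x, grad (I23 κ₂ β₂ β₃) x,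
        grad (I123 κ₂ β₁ β₂ β₃) x, grad H x] := by
  obtain ⟨r, hSr, hCr⟩ := exists_Sk_ne_zero_and_Ck_ne_zero κ₁
  obtain ⟨q, hang, hI⟩ := exists_quadratic_ne_zero
    (a := 4 * Real.cos φ * Real.sin φ / Sk κ₂ θ ^ 2) (by simp [hS, hcos, hsin])
    (2 * potentialDerivI12 κ₂ β₁ β₂ θ φ - 4 * Real.sin φ ^ 2 * Ck κ₂ θ / Sk κ₂ θ ^ 3
      - 2 * Real.cos φ ^ 2 * derivI123 κ₂ β₁ β₂ β₃ θ φ)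
    (2 * Real.cos φ * Real.sin φ * Ck κ₂ θ / Sk κ₂ θ * derivI123 κ₂ β₁ β₂ β₃ θ φ)
    (1 / Sk κ₂ θ ^ 2 + 2 * β₁ * κ₂ / Ck κ₂ θ ^ 2 + 2 * β₂ * κ₂ / (Sk κ₂ θ ^ 2 * Real.cos φ ^ 2)
      + 2 * β₃ * κ₂ / (Sk κ₂ θ ^ 2 * Real.sin φ ^ 2))
  set I := I123 κ₂ β₁ β₂ β₃ ![0, θ, φ, 0, q, 1] with hIdef
  have hI0 : I ≠ 0 := by
    convert hI using 1
    simp [hIdef, I123]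
    ring
  -- the radial minor is affine in `p` with slope `m * I / S ^ 2`
  obtain ⟨p, hp⟩ : ∃ p : ℝ, m * I / Sk κ₁ r ^ 2 * p
      - A q * (k / Sk κ₁ r ^ 2 - I / κ₂ * (Ck κ₁ r / Sk κ₁ r ^ 3)) ≠ 0 := by
    have h0 : m * I / Sk κ₁ r ^ 2 ≠ 0 := by simp [hm, hI0, hSr]
    refine ⟨(1 + A q * (k / Sk κ₁ r ^ 2 - I / κ₂ * (Ck κ₁ r / Sk κ₁ r ^ 3)))
      / (m * I / Sk κ₁ r ^ 2), ?_⟩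
    rw [mul_div_cancel₀ _ h0]
    simp
  have hx : ![r, θ, φ, p, q, 1] ∈ D κ₁ κ₂ := ⟨hSr, hCr, hS, hC, hcos, hsin⟩
  have u0 : ∀ t, Function.update ![r, θ, φ, p, q, 1] 0 t = ![t, θ, φ, p, q, 1] := by
    intro t; ext i; fin_cases i <;> rfl
  have u1 : ∀ t, Function.update ![r, θ, φ, p, q, 1] 1 t = ![r, t, φ, p, q, 1] := by
    intro t; ext i; fin_cases i <;> rfl
  have u3 : ∀ t, Function.update ![r, θ, φ, p, q, 1] 3 t = ![r, θ, φ, t, q, 1] := by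
    intro t; ext i; fin_cases i <;> rfl
  have u4 : ∀ t, Function.update ![r, θ, φ, p, q, 1] 4 t = ![r, θ, φ, p, t, 1] := by
    intro t; ext i; fin_cases i <;> rfl
  have u5 : ∀ t, Function.update ![r, θ, φ, p, q, 1] 5 t = ![r, θ, φ, p, q, t] := by
    intro t; ext i; fin_cases i <;> rfl
  have d12 := differentiableAt_I12 β₁ β₂ hx
  have d23 := differentiableAt_I23 β₂ β₃ hx
  have d123 := differentiableAt_I123 β₁ β₂ β₃ hx
  have hcot := hasDerivAt_Ck_div_Sk hSr
  have L0 : pd L 0 ![r, θ, φ, p, q, 1] = m * I / Sk κ₁ r ^ 2 := by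
    refine pd_eq_of_hasDerivAt _ (hLd _ hx) u0 ?_
    simp only [hL]
    refine (((hcot.const_mul (m * I)).const_sub (A q * p)).add_const (E q)).congr_deriv ?_
    ring
  have L3 : pd L 3 ![r, θ, φ, p, q, 1] = A q := by
    refine pd_eq_of_hasDerivAt _ (hLd _ hx) u3 ?_
    simp only [hL]
    refine ((((hasDerivAt_id' p).const_mul (A q)).sub_const _).add_const _).congr_deriv ?_
    ring
  have H0 : pd H 0 ![r, θ, φ, p, q, 1] =
      k / Sk κ₁ r ^ 2 - I / κ₂ * (Ck κ₁ r / Sk κ₁ r ^ 3) := by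
    refine pd_eq_of_hasDerivAt _ (hHd _ hx) u0 ?_
    simp only [hH]
    have := ((hcot.const_mul k).const_sub (p ^ 2 / 2)).add
      ((((hasDerivAt_Sk κ₁ r).pow 2).inv (pow_ne_zero 2 hSr)).const_mul (I / (2 * κ₂)))
    refine hasDerivAt_of_eq this (fun t => by simp [hIdef]) ?_
    simp
    field_simp
    ring
  have H3 : pd H 3 ![r, θ, φ, p, q, 1] = p := by
    refine pd_eq_of_hasDerivAt _ (hHd _ hx) u3 ?_
    simp only [hH]
    refine (((((hasDerivAt_id' p).pow 2).div_const 2).sub_const _).add_const _).congr_deriv ?_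
    simp
  have A1 := pd_eq_of_hasDerivAt _ d12 u1 (hasDerivAt_I12_theta β₁ β₂ r p q hS hC hcos)
  have A4 := pd_eq_of_hasDerivAt _ d12 u4 (hasDerivAt_I12_ptheta β₁ β₂ r p q)
  have B1 := pd_eq_of_hasDerivAt _ d123 u1 (hasDerivAt_I123_theta β₁ β₂ β₃ r p q hS hC hcos hsin)
  have B4 := pd_eq_of_hasDerivAt _ d123 u4 (hasDerivAt_I123_ptheta β₁ β₂ β₃ r p q)
  have G5 := pd_eq_of_hasDerivAt _ d23 u5 (hasDerivAt_I23_pphi β₂ β₃ r p q)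
  refine ⟨_, hx, linearIndependent_of_minors
    ⟨pd_eq_zero d12 ?_, pd_eq_zero d12 ?_⟩ ⟨pd_eq_zero d23 ?_, pd_eq_zero d23 ?_⟩
    ⟨pd_eq_zero d123 ?_, pd_eq_zero d123 ?_⟩ ?_
    ⟨pd_eq_zero d23 ?_, pd_eq_zero d23 ?_, ?_⟩ ?_⟩
  · simp [I12]
  · simp [I12]
  · simp [I23]
  · simp [I23]
  · simp [I123]
  · simp [I123]
  · simpa only [grad, L0, L3, H0, H3] using hp
  · simp [I23]
  · simp [I23]
  · simp [grad, G5]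
  · simp only [grad, A1, A4, B1, B4, Matrix.cons_val]
    convert hang using 1
    ring

/-- for each i ∈ {1,2,3}, the five functions
Lᵢ, I₁₂, I₂₃, I₁₂₃, H^GKC_i (with βᵢ absent, i.e. set to zero, in the angular
integrals) are functionally independent on D; hence each H^GKC_i is a maximally
superintegrable Hamiltonian. -/
theorem GKC_maximal_superintegrability (κ₁ κ₂ k β₁ β₂ β₃ : ℝ) (hκ₂ : κ₂ ≠ 0) :
    (∃ x ∈ D κ₁ κ₂, LinearIndependent ℝ
      ![grad (L1 κ₁ κ₂ k β₂ β₃) x, grad (I12 κ₂ 0 β₂) x, grad (I23 κ₂ β₂ β₃) x,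
        grad (I123 κ₂ 0 β₂ β₃) x, grad (HGKC1 κ₁ κ₂ k β₂ β₃) x]) ∧
    (∃ x ∈ D κ₁ κ₂, LinearIndependent ℝ
      ![grad (L2 κ₁ κ₂ k β₁ β₃) x, grad (I12 κ₂ β₁ 0) x, grad (I23 κ₂ 0 β₃) x,
        grad (I123 κ₂ β₁ 0 β₃) x, grad (HGKC2 κ₁ κ₂ k β₁ β₃) x]) ∧
    (∃ x ∈ D κ₁ κ₂, LinearIndependent ℝ
      ![grad (L3 κ₁ κ₂ k β₁ β₂) x, grad (I12 κ₂ β₁ β₂) x, grad (I23 κ₂ β₂ 0) x,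
        grad (I123 κ₂ β₁ β₂ 0) x, grad (HGKC3 κ₁ κ₂ k β₁ β₂) x]) := by
  obtain ⟨θ, hS, hC⟩ := exists_Sk_ne_zero_and_Ck_ne_zero κ₂
  have hcos : Real.cos 1 ≠ 0 := Real.cos_one_pos.ne'
  have hsin : Real.sin 1 ≠ 0 := (Real.sin_pos_of_pos_of_le_one one_pos le_rfl).ne'
  have hsc := Real.sin_sq_add_cos_sq 1
  refine ⟨?_, ?_, ?_⟩
  · refine exists_mem_D_linearIndependent (θ := θ) (φ := 1) (k := k) (m := Ck κ₂ θ)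
      (A := fun q => -κ₂ * Sk κ₂ θ * q) (E := fun _ => k * κ₂ * Ck κ₂ θ) hS hC hcos hsin hC
      ?_ ?_ (fun x hx => differentiableAt_L1 k β₂ β₃ hx)
      (fun x hx => differentiableAt_HGKC1 hκ₂ k β₂ β₃ hx)
    · intro r p q
      simp [L1, I123, J02, J03, J12, J13, Tk, div_mul_eq_mul_div, div_div_eq_mul_div]
      linear_combination (-κ₂ * Sk κ₂ θ * p * q - Ck κ₂ θ * q ^ 2 * (Ck κ₁ r / Sk κ₁ r)
        - Ck κ₂ θ * (Ck κ₁ r / Sk κ₁ r) / Sk κ₂ θ ^ 2) * hsc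
    · intro r p q
      simp [HGKC1, I123, Tkin, Tk]
      field_simp
      ring
  · refine exists_mem_D_linearIndependent (θ := θ) (φ := 1) (k := k) (m := Sk κ₂ θ * Real.cos 1)
      (A := fun q => Ck κ₂ θ * (Real.cos 1 * q - Real.sin 1 * (Ck κ₂ θ / Sk κ₂ θ))
        - κ₂ * Sk κ₂ θ * Real.sin 1)
      (E := fun _ => k * κ₂ * Sk κ₂ θ * Real.cos 1) hS hC hcos hsin (mul_ne_zero hS hcos)
      ?_ ?_ (fun x hx => differentiableAt_L2 k β₁ β₃ hx)
      (fun x hx => differentiableAt_HGKC2 hκ₂ k β₁ β₃ hx)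
    · intro r p q
      simp [L2, I123, J01, J03, J12, J23, Tk, div_eq_mul_inv]
      generalize (Sk κ₁ r)⁻¹ = y
      field_simp
      ring
    · intro r p q
      simp [HGKC2, I123, Tkin, Tk]
      field_simp
      ring
  · refine exists_mem_D_linearIndependent (θ := θ) (φ := 1) (k := k) (m := Sk κ₂ θ * Real.sin 1)
      (A := fun q => Ck κ₂ θ * (Real.sin 1 * q + Real.cos 1 * (Ck κ₂ θ / Sk κ₂ θ))
        + κ₂ * Sk κ₂ θ * Real.cos 1)
      (E := fun _ => k * κ₂ * Sk κ₂ θ * Real.sin 1) hS hC hcos hsin (mul_ne_zero hS hsin)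
      ?_ ?_ (fun x hx => differentiableAt_L3 k β₁ β₂ hx)
      (fun x hx => differentiableAt_HGKC3 hκ₂ k β₁ β₂ hx)
    · intro r p q
      simp [L3, I123, J01, J02, J13, J23, Tk, div_eq_mul_inv]
      generalize (Sk κ₁ r)⁻¹ = y
      field_simp
      ring
    · intro r p q
      simp [HGKC3, I123, Tkin, Tk]
      field_simp
      ring

end
end Paper
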